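/- (Bendixson criterion.) Let Ω ⊆ ℝ² be an open, simply connected region and let X = (P,Q) : Ω → ℝ² be a C¹ vector field whose divergence satisfies div X(z) = ∂P/∂x (z) + ∂Q/∂y (z) > 0 for every z ∈ Ω. Then the planar differential equation x' = P(x,y), y' = Q(x,y) possesses no periodic orbit that is entirely contained in Ω. -/

import Mathlib

section

open Complex Set Filter Topology MeasureTheory

/-- A regular simple closed curve in the plane: a `C¹` curve `c` with nowhere vanishing derivative
`c'` and minimal period `T` which is injective up to that period. -/
structure IsRegularSimpleLoop (c c' : ℝ → ℂ) (T : ℝ) : Prop where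
  pos : 0 < T
  hasDerivAt : ∀ t, HasDerivAt c (c' t) t
  continuous_deriv : Continuous c'
  deriv_ne_zero : ∀ t, c' t ≠ 0
  periodic : Function.Periodic c T
  inj : ∀ a b, c a = c b → ∃ n : ℤ, b = a + n * T

/-- The winding number of the loop `c` with derivative `c'` and period `T` around `z`. -/
noncomputable def loopWinding (c c' : ℝ → ℂ) (T : ℝ) (z : ℂ) : ℂ :=
  (2 * Real.pi * I)⁻¹ * ∫ t in (0 : ℝ)..T, c' t / (c t - z)

namespace IsRegularSimpleLoop

variable {c c' : ℝ → ℂ} {T : ℝ}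

theorem continuous (h : IsRegularSimpleLoop c c' T) : Continuous c :=
  continuous_iff_continuousAt.2 fun t => (h.hasDerivAt t).continuousAt

theorem periodic_deriv (h : IsRegularSimpleLoop c c' T) : Function.Periodic c' T := by
  intro t
  have h1 : HasDerivAt (fun s => c (s + T)) (c' (t + T)) t :=
    (h.hasDerivAt (t + T)).comp_add_const t T
  have h2 : (fun s => c (s + T)) = c := funext h.periodic
  rw [h2] at h1
  exact h1.unique (h.hasDerivAt t)

theorem range_eq (h : IsRegularSimpleLoop c c' T) : range c = c '' Icc 0 T := by
  have := h.periodic.image_Icc h.pos 0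
  rw [← this, zero_add]

theorem isCompact_range (h : IsRegularSimpleLoop c c' T) : IsCompact (range c) := by
  rw [h.range_eq]
  exact isCompact_Icc.image h.continuous

theorem sub_ne_zero {z : ℂ} (hz : z ∉ range c) (t : ℝ) : c t - z ≠ 0 := fun h0 =>
  hz ⟨t, _root_.sub_eq_zero.1 h0⟩

theorem continuous_integrand (h : IsRegularSimpleLoop c c' T) {z : ℂ} (hz : z ∉ range c) :
    Continuous fun t => c' t / (c t - z) :=
  h.continuous_deriv.div (h.continuous.sub continuous_const) (sub_ne_zero hz)

theorem exp_integral (h : IsRegularSimpleLoop c c' T) {z : ℂ} (hz : z ∉ range c) (t : ℝ) :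
    exp (∫ s in (0 : ℝ)..t, c' s / (c s - z)) * (c 0 - z) = c t - z := by
  have hI : ∀ t, HasDerivAt (fun t => ∫ s in (0 : ℝ)..t, c' s / (c s - z)) (c' t / (c t - z)) t :=
    fun t => ((h.continuous_integrand hz).integral_hasStrictDerivAt 0 t).hasDerivAt
  have hg : ∀ t, HasDerivAt (fun t => exp (-∫ s in (0 : ℝ)..t, c' s / (c s - z)) * (c t - z)) 0 t := by
    intro t
    convert! ((hI t).neg.cexp).mul ((h.hasDerivAt t).sub_const z) using 1
    have := sub_ne_zero hz t
    field_simp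
    ring
  have hc := is_const_of_deriv_eq_zero (fun t => (hg t).differentiableAt) (fun t => (hg t).deriv) t 0
  simp only [intervalIntegral.integral_same, neg_zero, exp_zero, one_mul] at hc
  rw [← hc, ← mul_assoc, ← exp_add]
  simp

theorem loopWinding_int (h : IsRegularSimpleLoop c c' T) {z : ℂ} (hz : z ∉ range c) :
    ∃ n : ℤ, loopWinding c c' T z = n := by
  have h1 := h.exp_integral hz T
  have h2 : c T = c 0 := by simpa using h.periodic 0
  rw [h2] at h1
  have h3 := mul_right_cancel₀ (sub_ne_zero hz 0) (h1.trans (one_mul _).symm)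
  obtain ⟨n, hn⟩ := exp_eq_one_iff.1 h3
  refine ⟨n, ?_⟩
  rw [loopWinding, hn]
  have := two_pi_I_ne_zero
  field_simp

/-- The winding number vanishes when the loop has a continuous logarithm seen from `z`. -/
theorem loopWinding_eq_zero_of_log (h : IsRegularSimpleLoop c c' T) {z : ℂ}
    {L : ℝ → ℂ} (hL : Continuous L) (hper : L T = L 0) (hexp : ∀ t, exp (L t) = c t - z) :
    loopWinding c c' T z = 0 := by
  have hz : z ∉ range c := by
    rintro ⟨t, rfl⟩
    exact exp_ne_zero (L t) (by simpa using hexp t)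
  have hderiv : ∀ t, HasDerivAt L (c' t / (c t - z)) t := by
    intro t
    have h2 : HasDerivAt (fun t => exp (L t)) (c' t) t := by
      simp_rw [hexp]
      exact (h.hasDerivAt t).sub_const z
    have h4 : HasDerivAt L ((c' t) / exp (L t)) t := by
      have key := hasStrictDerivAt_exp (L t)
      have hinv := key.to_localInverse (exp_ne_zero (L t))
      have hev := key.eventually_left_inverse (exp_ne_zero (L t))
      have hev2 := hL.continuousAt.eventually hev
      have h5 := HasDerivAt.comp_of_eq t (hinv.hasDerivAt) h2 rfl
      refine (h5.congr_of_eventuallyEq ?_).congr_deriv ?_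
      · filter_upwards [hev2] with s hs using hs.symm
      · rw [div_eq_inv_mul]
    rwa [hexp] at h4
  have h1 : ∫ t in (0 : ℝ)..T, c' t / (c t - z) = L T - L 0 :=
    intervalIntegral.integral_eq_sub_of_hasDerivAt (fun t _ => hderiv t)
      ((h.continuous_integrand hz).intervalIntegrable _ _)
  rw [loopWinding, h1, hper, sub_self, mul_zero]

/-- The Cauchy integral over a piece of the loop is continuous away from that piece. -/
theorem continuousAt_integral (h : IsRegularSimpleLoop c c' T) {a b : ℝ} (hab : a ≤ b) {z : ℂ}
    (hz : z ∉ c '' Icc a b) :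
    ContinuousAt (fun z => ∫ t in a..b, c' t / (c t - z)) z := by
  have hcl : IsClosed (c '' Icc a b) := (isCompact_Icc.image h.continuous).isClosed
  obtain ⟨ε, hε, hball⟩ := Metric.isOpen_iff.1 hcl.isOpen_compl z hz
  have hdist : ∀ t ∈ Icc a b, ∀ w ∈ Metric.ball z (ε / 2), ε / 2 ≤ ‖c t - w‖ := by
    intro t ht w hw
    by_contra hlt
    push Not at hlt
    refine hball (?_ : c t ∈ Metric.ball z ε) (mem_image_of_mem _ ht)
    rw [Metric.mem_ball] at hw ⊢
    rw [← dist_eq_norm] at hlt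
    linarith [dist_triangle (c t) w z]
  have hmeas : ∀ w, AEStronglyMeasurable (fun t => c' t / (c t - w)) (volume.restrict (uIoc a b)) :=
    fun w => (h.continuous_deriv.measurable.div
      (h.continuous.measurable.sub_const w)).aestronglyMeasurable
  refine intervalIntegral.continuousAt_of_dominated_interval
    (bound := fun t => ‖c' t‖ / (ε / 2)) (Eventually.of_forall hmeas) ?_
    ((h.continuous_deriv.norm.div_const _).intervalIntegrable _ _) ?_
  · filter_upwards [Metric.ball_mem_nhds z (half_pos hε)] with w hw
    refine Eventually.of_forall fun t ht => ?_
    rw [uIoc_of_le hab] at ht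
    rw [norm_div]
    gcongr
    exact hdist t (Ioc_subset_Icc_self ht) w hw
  · refine Eventually.of_forall fun t ht => ?_
    rw [uIoc_of_le hab] at ht
    have hne : c t - z ≠ 0 := fun h0 =>
      hz ⟨t, Ioc_subset_Icc_self ht, _root_.sub_eq_zero.1 h0⟩
    exact continuousAt_const.div (continuousAt_const.sub continuousAt_id) hne

theorem continuousAt_loopWinding (h : IsRegularSimpleLoop c c' T) {z : ℂ} (hz : z ∉ range c) :
    ContinuousAt (loopWinding c c' T) z :=
  continuousAt_const.mul (h.continuousAt_integral h.pos.le (h.range_eq ▸ hz))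

theorem loopWinding_const (h : IsRegularSimpleLoop c c' T) {α : Type*} [TopologicalSpace α]
    {S : Set α} (hS : IsPreconnected S) {f : α → ℂ} (hf : ContinuousOn f S)
    (hfr : ∀ x ∈ S, f x ∉ range c) {x y : α} (hx : x ∈ S) (hy : y ∈ S) :
    loopWinding c c' T (f x) = loopWinding c c' T (f y) := by
  have hcont : ContinuousOn (fun x => loopWinding c c' T (f x)) S := fun x hx =>
    ContinuousAt.comp_continuousWithinAt (g := loopWinding c c' T)
      (h.continuousAt_loopWinding (hfr x hx)) (hf x hx)
  choose! n hn using fun x (hx : x ∈ S) => h.loopWinding_int (hfr x hx)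
  have hn' : ContinuousOn n S := by
    rw [Int.isClosedEmbedding_coe_real.isEmbedding.continuousOn_iff]
    refine (continuous_re.comp_continuousOn hcont).congr fun x hx => ?_
    simp [hn x hx]
  rw [hn x hx, hn y hy, hS.constant hn' hx hy]

theorem exists_loopWinding_eq_zero (h : IsRegularSimpleLoop c c' T) :
    ∃ R : ℝ, ∀ z : ℂ, R < ‖z‖ → z ∉ range c ∧ loopWinding c c' T z = 0 := by
  obtain ⟨M, hM⟩ := h.isCompact_range.isBounded.exists_norm_le
  obtain ⟨N, hN⟩ := (isCompact_Icc (a := (0 : ℝ)) (b := T)).exists_bound_of_continuousOn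
    h.continuous_deriv.continuousOn
  have hM' : ∀ t, ‖c t‖ ≤ M := fun t => hM _ ⟨t, rfl⟩
  have hN0 : 0 ≤ N := (norm_nonneg _).trans (hN 0 ⟨le_rfl, h.pos.le⟩)
  refine ⟨M + (N + 1) * (T + 1), fun z hz => ?_⟩
  have hT := h.pos
  have hK : 0 < (N + 1) * (T + 1) := by positivity
  have hdist : ∀ t, (N + 1) * (T + 1) ≤ ‖c t - z‖ := fun t => by
    have := norm_sub_norm_le z (c t)
    rw [norm_sub_rev] at this
    linarith [hM' t]
  have hzr : z ∉ range c := by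
    rintro ⟨t, rfl⟩
    linarith [hM' t]
  refine ⟨hzr, ?_⟩
  have hbound : ‖∫ t in (0 : ℝ)..T, c' t / (c t - z)‖ ≤ N / ((N + 1) * (T + 1)) * |T - 0| := by
    refine intervalIntegral.norm_integral_le_of_norm_le_const fun t ht => ?_
    rw [uIoc_of_le hT.le] at ht
    rw [norm_div]
    gcongr
    · exact hN t (Ioc_subset_Icc_self ht)
    · exact hdist t
  have hlt : ‖∫ t in (0 : ℝ)..T, c' t / (c t - z)‖ < 1 := by
    refine hbound.trans_lt ?_
    rw [sub_zero, abs_of_pos hT, div_mul_eq_mul_div, div_lt_one hK]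
    nlinarith
  obtain ⟨n, hn⟩ := h.loopWinding_int hzr
  have h1 : ‖loopWinding c c' T z‖ < 1 := by
    rw [loopWinding, norm_mul, norm_inv]
    have h2 : 1 ≤ ‖(2 * Real.pi * I : ℂ)‖ := by
      simp only [norm_mul, norm_I, mul_one, norm_real, Real.norm_eq_abs, abs_of_pos Real.pi_pos,
        Complex.norm_ofNat]
      linarith [Real.pi_gt_three]
    calc _ ≤ 1 * ‖∫ t in (0 : ℝ)..T, c' t / (c t - z)‖ := by
          gcongr
          exact inv_le_one_of_one_le₀ h2
      _ < 1 := by rwa [one_mul]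
  rw [hn] at h1 ⊢
  rw [norm_intCast] at h1
  have : |n| < 1 := by exact_mod_cast h1
  rw [Int.abs_lt_one_iff.1 this, Int.cast_zero]


/-- Points close to the loop on its normal lines do not lie on the loop. -/
theorem eventually_normal_notMem_range (h : IsRegularSimpleLoop c c' T) (t₀ : ℝ) :
    ∀ᶠ p : ℝ × ℝ in 𝓝 (t₀, 0), p.2 ≠ 0 → c p.1 + p.2 * I * c' p.1 ∉ range c := by
  have hT := h.pos
  have hpos : ∀ᶠ q : ℝ × ℝ in 𝓝 (t₀, t₀), 0 < (star (c' q.1) * c' q.2).re := by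
    have h1 : Continuous fun q : ℝ × ℝ => (star (c' q.1) * c' q.2).re :=
      continuous_re.comp (((h.continuous_deriv.comp continuous_fst).star).mul
        (h.continuous_deriv.comp continuous_snd))
    refine h1.continuousAt.eventually (lt_mem_nhds ?_)
    have h2 := normSq_pos.2 (h.deriv_ne_zero t₀)
    simpa [normSq_apply] using h2
  obtain ⟨δ₁, hδ₁, hball⟩ := Metric.eventually_nhds_iff.1 hpos
  set δ := min (δ₁ / 2) (T / 4)
  have hδ : 0 < δ := by positivity
  have hδ1 : δ < δ₁ := (min_le_left _ _).trans_lt (by linarith)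
  have hK : IsClosed (c '' Icc (t₀ + δ) (t₀ - δ + T)) :=
    (isCompact_Icc.image h.continuous).isClosed
  have hΦ : Continuous fun p : ℝ × ℝ => c p.1 + p.2 * I * c' p.1 :=
    (h.continuous.comp continuous_fst).add
      (((continuous_ofReal.comp continuous_snd).mul continuous_const).mul
        (h.continuous_deriv.comp continuous_fst))
  have hnot : c t₀ + ((0 : ℝ) : ℂ) * I * c' t₀ ∈ (c '' Icc (t₀ + δ) (t₀ - δ + T))ᶜ := by
    rintro ⟨t, ht, htt⟩
    rw [ofReal_zero, zero_mul, zero_mul, add_zero] at htt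
    obtain ⟨n, hn⟩ := h.inj _ _ htt
    have h1 : (-1 : ℝ) < n := by
      by_contra! hle
      nlinarith [ht.2, ht.1]
    have h2 : (n : ℝ) < 0 := by
      by_contra! hle
      nlinarith [ht.2, ht.1]
    have h3 : -1 < n := by exact_mod_cast h1
    have h4 : n < 0 := by exact_mod_cast h2
    omega
  have hev1 := (hΦ.continuousAt (x := (t₀, 0))).eventually (hK.isOpen_compl.mem_nhds hnot)
  have hev2 : ∀ᶠ p : ℝ × ℝ in 𝓝 (t₀, 0), p.1 ∈ Ioo (t₀ - δ) (t₀ + δ) :=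
    continuous_fst.continuousAt.eventually (Ioo_mem_nhds (by simpa using hδ) (by simpa using hδ))
  filter_upwards [hev1, hev2] with p hp1 hp2 hne
  rintro ⟨t', ht'⟩
  obtain ⟨τ, hτ, hττ⟩ := h.periodic.exists_mem_Ico hT t' (t₀ - δ)
  rw [hττ] at ht'
  have hτ2 : τ < t₀ + δ := by
    by_contra! hle
    exact hp1 ⟨τ, ⟨hle, hτ.2.le⟩, ht'⟩
  set g : ℝ → ℝ := fun t => (star (c' p.1) * (c t - c p.1)).re with hg
  have hgd : ∀ t, HasDerivAt g (star (c' p.1) * c' t).re t := fun t =>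
    reCLM.hasFDerivAt.comp_hasDerivAt t (((h.hasDerivAt t).sub_const _).const_mul _)
  have hmono : StrictMonoOn g (Ico (t₀ - δ) (t₀ + δ)) := by
    refine strictMonoOn_of_deriv_pos (convex_Ico _ _)
      (fun t _ => (hgd t).continuousAt.continuousWithinAt) fun t ht => ?_
    rw [interior_Ico] at ht
    rw [(hgd t).deriv]
    refine hball (y := (p.1, t)) ?_
    rw [Prod.dist_eq, max_lt_iff, Real.dist_eq, Real.dist_eq, abs_lt, abs_lt]
    refine ⟨⟨?_, ?_⟩, ?_, ?_⟩ <;> linarith [ht.1, ht.2, hp2.1, hp2.2]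
  have heq : τ = p.1 := by
    refine hmono.injOn ⟨hτ.1, hτ2⟩ ⟨hp2.1.le, hp2.2⟩ ?_
    simp only [hg, ht', sub_self, mul_zero, zero_re, add_sub_cancel_left]
    simp
    ring
  rw [heq] at ht'
  have h0 : (p.2 : ℂ) * I * c' p.1 = 0 := by simpa using ht'
  simp [I_ne_zero, h.deriv_ne_zero, hne] at h0

theorem integral_div_sub_eq_log {v v' : ℝ → ℂ} {a b t₀ : ℝ} (hab : a ≤ b)
    (hv : ∀ t, HasDerivAt v (v' t) t) (hv' : Continuous v')
    (h0 : v t₀ = 0) (hre : ∀ t ∈ Icc a b, t ≠ t₀ → (v t).re ≠ 0)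
    {e : ℝ} (he : e = 1 ∨ e = -1) {s : ℝ} (hs : 0 < s) :
    ∫ t in a..b, v' t / (v t - e * s * I) =
      log (e * I * v b + s) - log (e * I * v a + s) := by
  have hee : (e : ℂ) * e = 1 := by rcases he with rfl | rfl <;> norm_num
  have hmem : ∀ t ∈ Icc a b, e * I * v t + s ∈ slitPlane := by
    intro t ht
    by_cases h : t = t₀
    · subst h
      simp [h0, hs]
    · right
      have := hre t ht h
      rcases he with rfl | rfl <;> simpa using this
  have hne : ∀ t ∈ Icc a b, v t - e * s * I ≠ 0 := by
    intro t ht h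
    apply slitPlane_ne_zero (hmem t ht)
    linear_combination (e * I) * h + (e * e * s) * I_sq - s * hee
  have hcv : Continuous v := continuous_iff_continuousAt.2 fun t => (hv t).continuousAt
  refine intervalIntegral.integral_eq_sub_of_hasDerivAt
    (f := fun t => log (e * I * v t + s)) (fun t ht => ?_) ?_
  · rw [uIcc_of_le hab] at ht
    have h1 : HasDerivAt (fun t => e * I * v t + s) (e * I * v' t) t :=
      ((hv t).const_mul _).add_const _
    refine (h1.clog_real (hmem t ht)).congr_deriv ?_
    rw [div_eq_div_iff (slitPlane_ne_zero (hmem t ht)) (hne t ht)]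
    linear_combination (- v' t * e * e * s) * I_sq + v' t * s * hee
  · refine ContinuousOn.intervalIntegrable ?_
    rw [uIcc_of_le hab]
    exact hv'.continuousOn.div (hcv.sub continuous_const).continuousOn hne

theorem log_sub_log_neg_of_im_pos {z : ℂ} (hz : 0 < z.im) : log z - log (-z) = Real.pi * I := by
  rw [log, log, norm_neg, arg_neg_eq_arg_sub_pi_of_im_pos hz]
  push_cast
  ring

theorem log_sub_log_neg_of_im_neg {z : ℂ} (hz : z.im < 0) : log z - log (-z) = -(Real.pi * I) := by
  rw [log, log, norm_neg, arg_neg_eq_arg_add_pi_of_im_neg hz]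
  push_cast
  ring

/-- The winding number jumps by one across the loop. -/
theorem tendsto_loopWinding_jump (h : IsRegularSimpleLoop c c' T) (t₀ : ℝ) :
    Tendsto (fun s : ℝ => loopWinding c c' T (c t₀ + s * I * c' t₀) -
      loopWinding c c' T (c t₀ + (-s : ℝ) * I * c' t₀)) (𝓝[>] 0) (𝓝 1) := by
  have hT := h.pos
  have hd0 := h.deriv_ne_zero t₀
  set v : ℝ → ℂ := fun t => (c t - c t₀) / c' t₀ with hv_def
  set v' : ℝ → ℂ := fun t => c' t / c' t₀ with hv'_def
  have hv : ∀ t, HasDerivAt v (v' t) t := fun t => ((h.hasDerivAt t).sub_const _).div_const _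
  have hv'c : Continuous v' := h.continuous_deriv.div_const _
  have h0 : v t₀ = 0 := by simp [hv_def]
  have hpos : ∀ᶠ t in 𝓝 t₀, 0 < (v' t).re := by
    refine (continuous_re.comp hv'c).continuousAt.eventually (lt_mem_nhds ?_)
    simp [hv'_def, hd0]
  obtain ⟨δ₁, hδ₁, hball⟩ := Metric.eventually_nhds_iff.1 hpos
  set δ := min (δ₁ / 2) (T / 4)
  have hδ : 0 < δ := by positivity
  have hδT : δ ≤ T / 4 := min_le_right _ _
  have hδ1 : δ < δ₁ := (min_le_left _ _).trans_lt (by linarith)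
  set a := t₀ - δ
  set b := t₀ + δ
  have hab : a ≤ b := by linarith
  have hmono : StrictMonoOn (fun t => (v t).re) (Icc a b) := by
    have hdre : ∀ t, HasDerivAt (fun t => (v t).re) (v' t).re t := fun t =>
      (reCLM.hasFDerivAt.comp_hasDerivAt t (hv t))
    refine strictMonoOn_of_deriv_pos (convex_Icc a b)
      (fun t _ => (hdre t).continuousAt.continuousWithinAt) fun t ht => ?_
    rw [interior_Icc] at ht
    rw [(hdre t).deriv]
    refine hball ?_
    rw [Real.dist_eq, abs_lt]
    constructor <;> linarith [ht.1, ht.2]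
  have ht₀ : t₀ ∈ Icc a b := ⟨by linarith, by linarith⟩
  have hre : ∀ t ∈ Icc a b, t ≠ t₀ → (v t).re ≠ 0 := by
    intro t ht hne h1
    refine hne (hmono.injOn ht ht₀ ?_)
    simp only [h1, h0, zero_re]
  have hva : (v a).re < 0 := by
    simpa [h0] using hmono ⟨le_rfl, hab⟩ ht₀ (by linarith : a < t₀)
  have hvb : 0 < (v b).re := by
    simpa [h0] using hmono ht₀ ⟨hab, le_rfl⟩ (by linarith : t₀ < b)
  set F : ℂ → ℂ := fun z => ∫ t in b..(a + T), c' t / (c t - z)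
  have hbT : b ≤ a + T := by linarith
  have hFc : ContinuousAt F (c t₀) := by
    refine h.continuousAt_integral hbT ?_
    rintro ⟨t, ht, htt⟩
    obtain ⟨n, hn⟩ := h.inj _ _ htt
    have h1 : (-1 : ℝ) < n := by
      by_contra! hle
      nlinarith [ht.2, ht.1]
    have h2 : (n : ℝ) < 0 := by
      by_contra! hle
      nlinarith [ht.2, ht.1]
    have h3 : -1 < n := by exact_mod_cast h1
    have h4 : n < 0 := by exact_mod_cast h2
    omega
  have hoff : ∀ᶠ s : ℝ in 𝓝[>] 0, c t₀ + s * I * c' t₀ ∉ range c ∧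
      c t₀ + (-s : ℝ) * I * c' t₀ ∉ range c := by
    have hev := h.eventually_normal_notMem_range t₀
    have h1 : Tendsto (fun s : ℝ => ((t₀, s) : ℝ × ℝ)) (𝓝[>] 0) (𝓝 (t₀, 0)) :=
      (Continuous.tendsto (by fun_prop) 0).mono_left nhdsWithin_le_nhds
    have h2 : Tendsto (fun s : ℝ => ((t₀, -s) : ℝ × ℝ)) (𝓝[>] 0) (𝓝 (t₀, 0)) := by
      have h3 : Continuous fun s : ℝ => ((t₀, -s) : ℝ × ℝ) := by fun_prop
      have h4 := h3.tendsto 0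
      rw [neg_zero] at h4
      exact h4.mono_left nhdsWithin_le_nhds
    filter_upwards [h1.eventually hev, h2.eventually hev, self_mem_nhdsWithin] with s e1 e2 hs
    exact ⟨e1 (ne_of_gt hs), e2 (neg_ne_zero.2 (ne_of_gt hs))⟩
  have hlogc : ∀ e : ℝ, e = 1 ∨ e = -1 → ∀ t, (v t).re ≠ 0 →
      Tendsto (fun s : ℝ => log (e * I * v t + s)) (𝓝[>] 0) (𝓝 (log (e * I * v t))) := by
    intro e he t ht
    have h1 : ContinuousAt (fun s : ℝ => log (e * I * v t + s)) 0 := by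
      refine ContinuousAt.clog (by fun_prop) ?_
      right
      rcases he with rfl | rfl <;> simpa using ht
    have h2 := h1.tendsto
    simp only [ofReal_zero, add_zero] at h2
    exact h2.mono_left nhdsWithin_le_nhds
  have hFlim : ∀ e : ℝ, Tendsto (fun s : ℝ => F (c t₀ + (e * s : ℝ) * I * c' t₀)) (𝓝[>] 0)
      (𝓝 (F (c t₀))) := by
    intro e
    refine hFc.tendsto.comp ?_
    have h1 : Continuous fun s : ℝ => c t₀ + (e * s : ℝ) * I * c' t₀ := by fun_prop
    have h2 := h1.tendsto 0
    simp only [mul_zero, ofReal_zero, zero_mul, add_zero] at h2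
    exact h2.mono_left nhdsWithin_le_nhds
  have hsplit : ∀ e : ℝ, e = 1 ∨ e = -1 → ∀ s : ℝ, 0 < s →
      c t₀ + (e * s : ℝ) * I * c' t₀ ∉ range c →
      loopWinding c c' T (c t₀ + (e * s : ℝ) * I * c' t₀) = (2 * Real.pi * I)⁻¹ *
        (log (e * I * v b + s) - log (e * I * v a + s) + F (c t₀ + (e * s : ℝ) * I * c' t₀)) := by
    intro e he s hs hoff
    rw [loopWinding]
    congr 1
    have hper : Function.Periodic (fun t => c' t / (c t - (c t₀ + (e * s : ℝ) * I * c' t₀))) T := by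
      intro t
      simp only [h.periodic t, h.periodic_deriv t]
    have hint := h.continuous_integrand hoff
    have h1 := hper.intervalIntegral_add_eq 0 a
    rw [zero_add] at h1
    rw [h1, ← intervalIntegral.integral_add_adjacent_intervals
      (hint.intervalIntegrable a b) (hint.intervalIntegrable b (a + T))]
    congr 1
    rw [← integral_div_sub_eq_log hab hv hv'c h0 hre he hs]
    refine intervalIntegral.integral_congr fun t _ => ?_
    simp only [hv_def, hv'_def]
    have h2 : (c t - c t₀) / c' t₀ - e * s * I =
        (c t - (c t₀ + (e * s : ℝ) * I * c' t₀)) / c' t₀ := by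
      push_cast
      field_simp
      ring
    rw [h2, div_div_div_cancel_right₀ hd0]
  have hlim := ((((hlogc 1 (Or.inl rfl) b hvb.ne').sub (hlogc 1 (Or.inl rfl) a hva.ne)).add
    (hFlim 1)).const_mul ((2 * Real.pi * I : ℂ)⁻¹)).sub
    ((((hlogc (-1) (Or.inr rfl) b hvb.ne').sub (hlogc (-1) (Or.inr rfl) a hva.ne)).add
    (hFlim (-1))).const_mul ((2 * Real.pi * I : ℂ)⁻¹))
  have hval : (1 : ℂ) = (2 * Real.pi * I)⁻¹ * (log ((1 : ℝ) * I * v b) - log ((1 : ℝ) * I * v a) + F (c t₀)) -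
      (2 * Real.pi * I)⁻¹ * (log ((-1 : ℝ) * I * v b) - log ((-1 : ℝ) * I * v a) + F (c t₀)) := by
    have h1 := log_sub_log_neg_of_im_pos (z := I * v b) (by simpa using hvb)
    have h2 := log_sub_log_neg_of_im_neg (z := I * v a) (by simpa using hva)
    have h3 := two_pi_I_ne_zero
    push_cast
    rw [← mul_sub, eq_inv_mul_iff_mul_eq₀ h3]
    simp only [one_mul, neg_mul]
    linear_combination h2 - h1
  rw [hval]
  refine hlim.congr' ?_
  filter_upwards [hoff, self_mem_nhdsWithin] with s hs hs0
  have e1 := hsplit 1 (Or.inl rfl) s hs0 (by simpa only [one_mul] using hs.1)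
  have e2 := hsplit (-1) (Or.inr rfl) s hs0 (by simpa only [neg_one_mul] using hs.2)
  rw [← e1, ← e2]
  simp only [one_mul, neg_one_mul]

/-- The winding numbers on both sides of the loop are locally constant along the loop. -/
theorem exists_eventually_sides (h : IsRegularSimpleLoop c c' T) (t₀ : ℝ) :
    ∃ k : ℤ, ∀ᶠ t in 𝓝 t₀, ∀ᶠ s : ℝ in 𝓝[>] 0,
      loopWinding c c' T (c t + s * I * c' t) = k + 1 ∧
      loopWinding c c' T (c t + (-s : ℝ) * I * c' t) = k ∧
      c t + s * I * c' t ∉ range c ∧ c t + (-s : ℝ) * I * c' t ∉ range c := by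
  obtain ⟨ε, hε, hball⟩ := Metric.eventually_nhds_iff.1 (h.eventually_normal_notMem_range t₀)
  have hoff : ∀ t ∈ Ioo (t₀ - ε) (t₀ + ε), ∀ s ∈ Ioo (-ε) ε, s ≠ 0 →
      c t + s * I * c' t ∉ range c := by
    intro t ht s hs hs0
    refine hball (y := (t, s)) ?_ hs0
    rw [Prod.dist_eq, max_lt_iff, Real.dist_eq, Real.dist_eq, abs_lt, abs_lt]
    refine ⟨⟨?_, ?_⟩, ?_, ?_⟩ <;> linarith [ht.1, ht.2, hs.1, hs.2]
  have hΦ : ∀ e : ℝ, Continuous fun p : ℝ × ℝ => c p.1 + (e * p.2 : ℝ) * I * c' p.1 := fun e =>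
    (h.continuous.comp continuous_fst).add
      (((continuous_ofReal.comp (continuous_const.mul continuous_snd)).mul continuous_const).mul
        (h.continuous_deriv.comp continuous_fst))
  set S : Set (ℝ × ℝ) := Ioo (t₀ - ε) (t₀ + ε) ×ˢ Ioo 0 ε
  have hSc : IsPreconnected S := isPreconnected_Ioo.prod isPreconnected_Ioo
  have hmem : (t₀, ε / 2) ∈ S := by
    refine ⟨⟨?_, ?_⟩, ?_, ?_⟩ <;> dsimp <;> linarith
  have hSoff : ∀ e : ℝ, e = 1 ∨ e = -1 → ∀ p ∈ S, c p.1 + (e * p.2 : ℝ) * I * c' p.1 ∉ range c := by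
    rintro e he p ⟨hp1, hp2⟩
    refine hoff _ hp1 _ ?_ ?_
    · rcases he with rfl | rfl <;> constructor <;> linarith [hp2.1, hp2.2]
    · rcases he with rfl | rfl <;> simpa using hp2.1.ne'
  have hconst : ∀ e : ℝ, e = 1 ∨ e = -1 → ∀ p ∈ S,
      loopWinding c c' T (c p.1 + (e * p.2 : ℝ) * I * c' p.1) =
      loopWinding c c' T (c t₀ + (e * (ε / 2) : ℝ) * I * c' t₀) := by
    intro e he p hp
    exact h.loopWinding_const (f := fun p : ℝ × ℝ => c p.1 + (e * p.2 : ℝ) * I * c' p.1)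
      (x := p) (y := (t₀, ε / 2)) hSc (hΦ e).continuousOn (hSoff e he) hp hmem
  obtain ⟨k, hk⟩ : ∃ k : ℤ, loopWinding c c' T (c t₀ + (-1 * (ε / 2) : ℝ) * I * c' t₀) = k :=
    h.loopWinding_int (hSoff (-1) (Or.inr rfl) (t₀, ε / 2) hmem)
  have hmemS : ∀ t ∈ Ioo (t₀ - ε) (t₀ + ε), ∀ᶠ s : ℝ in 𝓝[>] 0, (t, s) ∈ S := fun t ht => by
    filter_upwards [Ioo_mem_nhdsGT hε] with s hs using ⟨ht, hs⟩
  have hjump : loopWinding c c' T (c t₀ + (1 * (ε / 2) : ℝ) * I * c' t₀) = k + 1 := by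
    have h1 := h.tendsto_loopWinding_jump t₀
    have h2 : Tendsto (fun s : ℝ => loopWinding c c' T (c t₀ + s * I * c' t₀) -
      loopWinding c c' T (c t₀ + (-s : ℝ) * I * c' t₀)) (𝓝[>] 0)
      (𝓝 (loopWinding c c' T (c t₀ + (1 * (ε / 2) : ℝ) * I * c' t₀) - k)) := by
      refine tendsto_const_nhds.congr' ?_
      filter_upwards [hmemS t₀ ⟨by linarith, by linarith⟩] with s hs
      rw [← hk, ← hconst 1 (Or.inl rfl) _ hs, ← hconst (-1) (Or.inr rfl) _ hs]
      simp only [one_mul, neg_one_mul]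
    rw [← sub_eq_iff_eq_add']
    exact tendsto_nhds_unique h2 h1
  refine ⟨k, ?_⟩
  filter_upwards [Ioo_mem_nhds (by linarith : t₀ - ε < t₀) (by linarith : t₀ < t₀ + ε)] with t ht
  filter_upwards [hmemS t ht] with s hs
  have e1 := hconst 1 (Or.inl rfl) _ hs
  have e2 := hconst (-1) (Or.inr rfl) _ hs
  have e3 := hSoff 1 (Or.inl rfl) _ hs
  have e4 := hSoff (-1) (Or.inr rfl) _ hs
  rw [hjump] at e1
  rw [hk] at e2
  simp only [one_mul, neg_one_mul] at e1 e2 e3 e4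
  exact ⟨e1, e2, e3, e4⟩

theorem exists_sides (h : IsRegularSimpleLoop c c' T) :
    ∃ k : ℤ, ∀ t, ∀ᶠ s : ℝ in 𝓝[>] 0,
      loopWinding c c' T (c t + s * I * c' t) = k + 1 ∧
      loopWinding c c' T (c t + (-s : ℝ) * I * c' t) = k ∧
      c t + s * I * c' t ∉ range c ∧ c t + (-s : ℝ) * I * c' t ∉ range c := by
  choose k hk using h.exists_eventually_sides
  have hloc : IsLocallyConstant k := by
    refine IsLocallyConstant.iff_eventually_eq k |>.2 fun t₀ => ?_
    filter_upwards [hk t₀] with t ht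
    obtain ⟨s, hs1, hs2⟩ := (ht.and (hk t).self_of_nhds).exists
    exact_mod_cast hs2.2.1.symm.trans hs1.2.1
  refine ⟨k 0, fun t => ?_⟩
  rw [hloc.apply_eq_of_isPreconnected isPreconnected_univ (mem_univ 0) (mem_univ t)]
  exact (hk t).self_of_nhds

/-- Every point off the loop is joined to the loop by a normal segment. -/
theorem exists_normal_segment (h : IsRegularSimpleLoop c c' T) {z : ℂ} (hz : z ∉ range c) :
    ∃ t s : ℝ, s ≠ 0 ∧ ∀ r ∈ Ioc (0 : ℝ) 1,
      loopWinding c c' T (c t + (r * s : ℝ) * I * c' t) = loopWinding c c' T z := by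
  obtain ⟨_, ⟨t, rfl⟩, hmin⟩ := h.isCompact_range.exists_isMinOn (range_nonempty c)
    (f := fun w => normSq (w - z)) (by
      refine Continuous.continuousOn ?_
      exact continuous_normSq.comp (continuous_id.sub continuous_const))
  have hmin' : ∀ τ, normSq (c t - z) ≤ normSq (c τ - z) := fun τ => hmin (mem_range_self τ)
  have hd := h.hasDerivAt t
  have hre : HasDerivAt (fun τ => (c τ - z).re) (c' t).re t :=
    reCLM.hasFDerivAt.comp_hasDerivAt t (hd.sub_const z)
  have him : HasDerivAt (fun τ => (c τ - z).im) (c' t).im t :=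
    imCLM.hasFDerivAt.comp_hasDerivAt t (hd.sub_const z)
  have hsq := (hre.mul hre).add (him.mul him)
  have h0 := IsLocalMin.hasDerivAt_eq_zero (f := fun τ => normSq (c τ - z))
    (Eventually.of_forall hmin') (hsq.congr_of_eventuallyEq
      (Eventually.of_forall fun τ => normSq_apply _))
  have hN : 0 < (c' t).re * (c' t).re + (c' t).im * (c' t).im := by
    rw [← normSq_apply]
    exact normSq_pos.2 (h.deriv_ne_zero t)
  set N := (c' t).re * (c' t).re + (c' t).im * (c' t).im
  obtain ⟨s, e1⟩ : ∃ s : ℝ, s * N = (z - c t).im * (c' t).re - (z - c t).re * (c' t).im :=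
    ⟨_, div_mul_cancel₀ _ hN.ne'⟩
  have hzs : z = c t + s * I * c' t := by
    simp only [sub_re, sub_im] at e1 h0
    apply Complex.ext
    · simp
      apply mul_right_cancel₀ hN.ne'
      linear_combination (c' t).im * e1 - (c' t).re * h0 / 2
    · simp
      apply mul_right_cancel₀ hN.ne'
      linear_combination (-(c' t).re) * e1 - (c' t).im * h0 / 2
  have hs0 : s ≠ 0 := by
    intro hs
    rw [hs] at hzs
    exact hz ⟨t, by simpa using hzs.symm⟩
  refine ⟨t, s, hs0, fun r hr => ?_⟩
  have hoff : ∀ r ∈ Ioc (0 : ℝ) 1, c t + (r * s : ℝ) * I * c' t ∉ range c := by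
    rintro r hr ⟨τ, hτ⟩
    have h1 := hmin' τ
    have e1 : c t - z = -(s * I * c' t) := by rw [hzs]; ring
    have e2 : c τ - z = ((r - 1 : ℝ) : ℂ) * (s * I * c' t) := by
      rw [hτ, hzs]
      push_cast
      ring
    rw [e1, e2, normSq_neg, normSq_mul ((r - 1 : ℝ) : ℂ), normSq_ofReal] at h1
    have h2 : 0 < normSq (s * I * c' t) := by
      rw [normSq_pos]
      simp [hs0, I_ne_zero, h.deriv_ne_zero t]
    have h3 : (r - 1) * (r - 1) < 1 := by nlinarith [hr.1, hr.2]
    nlinarith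
  have hcont : Continuous fun r : ℝ => c t + (r * s : ℝ) * I * c' t := by fun_prop
  have h1 := h.loopWinding_const isPreconnected_Ioc hcont.continuousOn hoff hr
    (right_mem_Ioc.2 zero_lt_one)
  rw [h1, one_mul, ← hzs]

/-- A regular simple loop winds either zero times or `σ` times around each point of its complement,
for a sign `σ`, and the second case does occur. -/
theorem exists_sign (h : IsRegularSimpleLoop c c' T) :
    ∃ σ : ℝ, (σ = 1 ∨ σ = -1) ∧
      (∀ z ∉ range c, loopWinding c c' T z = 0 ∨ loopWinding c c' T z = σ) ∧
      ∃ z ∉ range c, loopWinding c c' T z = σ := by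
  obtain ⟨k, hk⟩ := h.exists_sides
  have hval : ∀ z ∉ range c, loopWinding c c' T z = k + 1 ∨ loopWinding c c' T z = k := by
    intro z hz
    obtain ⟨t, s, hs0, hs⟩ := h.exists_normal_segment hz
    have hev : ∀ e : ℝ, 0 < e → ∀ᶠ x : ℝ in 𝓝[>] 0, x / e ∈ Ioc (0 : ℝ) 1 := by
      intro e he
      filter_upwards [Ioo_mem_nhdsGT he] with x hx
      exact ⟨div_pos hx.1 he, (div_le_one he).2 hx.2.le⟩
    rcases lt_or_gt_of_ne hs0 with hneg | hpos
    · right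
      obtain ⟨x, hx1, hx2⟩ := ((hk t).and (hev (-s) (neg_pos.2 hneg))).exists
      rw [← hs _ hx2, ← hx1.2.1, div_neg, neg_mul, div_mul_cancel₀ _ hs0]
    · left
      obtain ⟨x, hx1, hx2⟩ := ((hk t).and (hev s hpos)).exists
      rw [← hs _ hx2, ← hx1.1, div_mul_cancel₀ _ hs0]
  obtain ⟨R, hR⟩ := h.exists_loopWinding_eq_zero
  obtain ⟨hfar, hfar0⟩ := hR ((|R| + 1 : ℝ) : ℂ) (by
    rw [norm_real, Real.norm_eq_abs, abs_of_pos (by positivity)]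
    linarith [le_abs_self R])
  obtain ⟨x, hx1, hx2, hx3, hx4⟩ := (hk 0).exists
  rcases hval _ hfar with hfar1 | hfar1
  · have hk0 : (k : ℂ) = -1 := by
      rw [hfar0] at hfar1
      linear_combination -hfar1
    rw [hk0] at hval hx2
    refine ⟨-1, Or.inr rfl, fun z hz => ?_, _, hx4, by simpa using hx2⟩
    simpa using hval z hz
  · have hk0 : (k : ℂ) = 0 := by rw [← hfar1, hfar0]
    rw [hk0] at hval hx1
    refine ⟨1, Or.inl rfl, fun z hz => ?_, _, hx3, by simpa using hx1⟩
    simpa using (hval z hz).symm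

end IsRegularSimpleLoop

/-- Twice the Wirtinger derivative of `φ` with respect to the conjugate variable. -/
noncomputable def dbar (φ : ℂ → ℂ) (z : ℂ) : ℂ := fderiv ℝ φ z 1 + I * fderiv ℝ φ z I

theorem continuous_dbar {φ : ℂ → ℂ} (hφ : ContDiff ℝ 1 φ) : Continuous (dbar φ) := by
  have := hφ.continuous_fderiv one_ne_zero
  unfold dbar
  fun_prop

theorem dbar_eq_zero {φ : ℂ → ℂ} {z : ℂ} (hz : z ∉ tsupport φ) : dbar φ z = 0 := by
  simp [dbar, fderiv_of_notMem_tsupport (𝕜 := ℝ) hz]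

theorem norm_circle_point (r θ : ℝ) :
    ‖(r * (Real.cos θ + Real.sin θ * I) : ℂ)‖ = |r| := by
  rw [← Complex.polarCoord_symm_apply (r, θ), Complex.norm_polarCoord_symm]

/-- The **Cauchy–Pompeiu formula** for compactly supported functions. -/
theorem integral_dbar_div {φ : ℂ → ℂ} (hφ : ContDiff ℝ 1 φ) (hs : HasCompactSupport φ) (a : ℂ) :
    ∫ η : ℂ, dbar φ (a + η) / η = -(2 * Real.pi) * φ a := by
  obtain ⟨M, hM⟩ := hs.isCompact.isBounded.exists_norm_le
  set R := |M| + ‖a‖ + 1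
  have hR0 : 0 < R := by positivity
  set E : ℝ → ℂ := fun θ => Real.cos θ + Real.sin θ * I with hE
  set F : ℝ → ℂ := fun θ => -Real.sin θ + Real.cos θ * I with hF
  have hEd : ∀ θ, HasDerivAt E (F θ) θ := fun θ => by
    refine ((Real.hasDerivAt_cos θ).ofReal_comp.add
      ((Real.hasDerivAt_sin θ).ofReal_comp.mul_const I)).congr_deriv ?_
    simp only [hF, ofReal_neg]
  have hEn : ∀ r θ : ℝ, ‖(r * E θ : ℂ)‖ = |r| := norm_circle_point
  have hE0 : ∀ θ, E θ ≠ 0 := fun θ h0 => by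
    have := hEn 1 θ
    simp [h0] at this
  have hout : ∀ r θ : ℝ, R ≤ |r| → a + r * E θ ∉ tsupport φ := fun r θ hr hmem => by
    have h1 := hM _ hmem
    have h2 : ‖(r * E θ : ℂ)‖ ≤ ‖a + r * E θ‖ + ‖a‖ := by
      simpa using norm_sub_le (a + r * E θ) a
    rw [hEn] at h2
    linarith [le_abs_self M]
  have hfd : ∀ z, HasFDerivAt φ (fderiv ℝ φ z) z := fun z =>
    (hφ.differentiable one_ne_zero z).hasFDerivAt
  -- the radial and angular derivatives
  set A : ℝ × ℝ → ℂ := fun p => fderiv ℝ φ (a + p.1 * E p.2) (E p.2) with hA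
  set B : ℝ × ℝ → ℂ := fun p => fderiv ℝ φ (a + p.1 * E p.2) (F p.2) with hB
  have hAc : Continuous A := by fun_prop
  have hBc : Continuous B := by fun_prop
  have hpt : ∀ p ∈ polarCoord.target, p.1 • (dbar φ (a + Complex.polarCoord.symm p) /
      Complex.polarCoord.symm p) = A p + I * B p := by
    rintro ⟨r, θ⟩ hp
    have hr : r ≠ 0 := ne_of_gt hp.1
    rw [Complex.polarCoord_symm_apply]
    change (r : ℝ) • (dbar φ (a + r * E θ) / (r * E θ)) = A (r, θ) + I * B (r, θ)
    have hlin : ∀ x y : ℝ, fderiv ℝ φ (a + r * E θ) (x + y * I) =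
        x * fderiv ℝ φ (a + r * E θ) 1 + y * fderiv ℝ φ (a + r * E θ) I := fun x y => by
      have : (x + y * I : ℂ) = x • (1 : ℂ) + y • I := by simp
      rw [this, map_add, map_smul, map_smul]
      simp
    have e1 : A (r, θ) = (Real.cos θ : ℂ) * fderiv ℝ φ (a + r * E θ) 1 +
        Real.sin θ * fderiv ℝ φ (a + r * E θ) I := hlin _ _
    have e2 : B (r, θ) = -(Real.sin θ : ℂ) * fderiv ℝ φ (a + r * E θ) 1 +
        Real.cos θ * fderiv ℝ φ (a + r * E θ) I := by
      simpa only [ofReal_neg] using hlin (-Real.sin θ) (Real.cos θ)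
    have hr' : (r : ℂ) ≠ 0 := by exact_mod_cast hr
    have e3 : r • (dbar φ (a + r * E θ) / (r * E θ)) = dbar φ (a + r * E θ) / E θ := by
      rw [real_smul]
      field_simp
    have e4 : (Real.cos θ : ℂ) ^ 2 + (Real.sin θ : ℂ) ^ 2 = 1 := by
      exact_mod_cast Real.cos_sq_add_sin_sq θ
    rw [e1, e2, e3, div_eq_iff (hE0 θ)]
    simp only [dbar, hE]
    set f1 := fderiv ℝ φ (a + r * (Real.cos θ + Real.sin θ * I)) 1
    set f2 := fderiv ℝ φ (a + r * (Real.cos θ + Real.sin θ * I)) I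
    linear_combination -(f1 + I * f2) * e4 +
      (f1 * (Real.sin θ : ℂ) ^ 2 - f2 * Real.cos θ * Real.sin θ) * I_sq
  set S : Set (ℝ × ℝ) := Ioc 0 R ×ˢ Ioo (-Real.pi) Real.pi with hS
  have hcompact : IsCompact (Icc 0 R ×ˢ Icc (-Real.pi) Real.pi) := isCompact_Icc.prod isCompact_Icc
  have hsub : S ⊆ Icc 0 R ×ˢ Icc (-Real.pi) Real.pi :=
    prod_mono Ioc_subset_Icc_self Ioo_subset_Icc_self
  have hAi : IntegrableOn A S := (hAc.continuousOn.integrableOn_compact hcompact).mono_set hsub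
  have hBi : IntegrableOn B S := (hBc.continuousOn.integrableOn_compact hcompact).mono_set hsub
  have hAint : ∫ p in S, A p = -(2 * Real.pi) * φ a := by
    rw [Measure.volume_eq_prod, hS, ← setIntegral_prod_swap, setIntegral_prod]
    · have hinner : ∀ θ : ℝ, ∫ r in Ioc 0 R, A (r, θ) = -φ a := by
        intro θ
        have hd : ∀ r : ℝ, HasDerivAt (fun r : ℝ => φ (a + r * E θ)) (A (r, θ)) r := fun r => by
          have h1 : HasDerivAt (fun r : ℝ => a + r * E θ) (E θ) r := by
            simpa using ((hasDerivAt_id r).ofReal_comp.mul_const (E θ)).const_add a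
          exact (hfd _).comp_hasDerivAt r h1
        rw [← intervalIntegral.integral_of_le hR0.le,
          intervalIntegral.integral_eq_sub_of_hasDerivAt (fun r _ => hd r)
            ((by fun_prop : Continuous fun r => A (r, θ)).intervalIntegrable _ _),
          image_eq_zero_of_notMem_tsupport (hout R θ (le_abs_self R))]
        simp
      simp only [Prod.swap_prod_mk, hinner, setIntegral_const]
      rw [Real.volume_real_Ioo_of_le (by linarith [Real.pi_pos]), real_smul]
      push_cast
      ring
    · rw [IntegrableOn, ← Measure.prod_restrict]
      rw [IntegrableOn, hS, Measure.volume_eq_prod, ← Measure.prod_restrict] at hAi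
      exact hAi.swap
  have hBint : ∫ p in S, B p = 0 := by
    rw [Measure.volume_eq_prod, hS, setIntegral_prod _ hBi]
    refine setIntegral_eq_zero_of_forall_eq_zero fun r hr => ?_
    have hr0 : (r : ℂ) ≠ 0 := by exact_mod_cast hr.1.ne'
    have hd : ∀ θ : ℝ, HasDerivAt (fun θ : ℝ => (r : ℂ)⁻¹ * φ (a + r * E θ)) (B (r, θ)) θ :=
        fun θ => by
      have h1 : HasDerivAt (fun θ : ℝ => a + r * E θ) (r * F θ) θ :=
        ((hEd θ).const_mul _).const_add a
      refine (((hfd _).comp_hasDerivAt θ h1).const_mul (r : ℂ)⁻¹).congr_deriv ?_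
      have e : fderiv ℝ φ (a + r * E θ) (r * F θ) = r * fderiv ℝ φ (a + r * E θ) (F θ) := by
        have e' : (r * F θ : ℂ) = r • F θ := real_smul.symm
        rw [e', map_smul, real_smul]
      rw [e, inv_mul_cancel_left₀ hr0]
    rw [← integral_Ioc_eq_integral_Ioo, ← intervalIntegral.integral_of_le (by linarith [Real.pi_pos]),
      intervalIntegral.integral_eq_sub_of_hasDerivAt (fun r _ => hd r)
        ((by fun_prop : Continuous fun θ => B (r, θ)).intervalIntegrable _ _)]
    simp [hE]
  rw [← Complex.integral_comp_polarCoord_symm, setIntegral_congr_fun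
    polarCoord.open_target.measurableSet hpt]
  have hrestrict : ∫ p in polarCoord.target, A p + I * B p = ∫ p in S, A p + I * B p := by
    refine setIntegral_eq_of_subset_of_forall_sdiff_eq_zero
      polarCoord.open_target.measurableSet ?_ ?_
    · rintro ⟨r, θ⟩ ⟨hr, hθ⟩
      exact ⟨hr.1, hθ⟩
    · rintro ⟨r, θ⟩ ⟨⟨hr, hθ⟩, hnot⟩
      have hrR : R ≤ |r| := by
        by_contra! hlt
        exact hnot ⟨⟨hr, (le_abs_self r).trans hlt.le⟩, hθ⟩
      simp [hA, hB, fderiv_of_notMem_tsupport (𝕜 := ℝ) (hout r θ hrR)]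
  rw [hrestrict, integral_add hAi (hBi.const_mul I), integral_const_mul, hAint, hBint]
  ring

theorem integrableOn_ball_inv_norm (R : ℝ) :
    IntegrableOn (fun z : ℂ => ‖z‖⁻¹) (Metric.ball 0 R) := by
  rw [integrableOn_fun_norm_addHaar volume (f := fun y : ℝ => y⁻¹), finrank_real_complex]
  refine (integrableOn_const (C := (1 : ℝ)) (by simp)).congr_fun (fun y hy => ?_) measurableSet_Ioo
  simp [hy.1.ne']

namespace IsRegularSimpleLoop

variable {c c' : ℝ → ℂ} {T : ℝ}

theorem integrable_kernel (h : IsRegularSimpleLoop c c' T) {φ : ℂ → ℂ} (hφ : ContDiff ℝ 1 φ)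
    (hs : HasCompactSupport φ) :
    Integrable (Function.uncurry fun (t : ℝ) (z : ℂ) => c' t * (dbar φ z / (z - c t)))
      ((volume.restrict (uIoc 0 T)).prod volume) := by
  obtain ⟨M, hM⟩ := hs.isCompact.isBounded.exists_norm_le
  obtain ⟨M', hM'⟩ := h.isCompact_range.isBounded.exists_norm_le
  have hsD : HasCompactSupport (dbar φ) :=
    hs.of_isClosed_subset (isClosed_tsupport _) (closure_minimal (fun z hz => by
      by_contra hnot
      exact hz (dbar_eq_zero hnot)) (isClosed_tsupport _))
  obtain ⟨D, hD⟩ := (continuous_dbar hφ).bounded_above_of_compact_support hsD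
  obtain ⟨N, hN⟩ := (isCompact_Icc (a := (0 : ℝ)) (b := T)).exists_bound_of_continuousOn
    h.continuous_deriv.continuousOn
  have hD0 : 0 ≤ D := (norm_nonneg _).trans (hD 0)
  set R := M + M' + 1
  set k : ℂ → ℝ := (Metric.ball 0 R).indicator fun z => D * ‖z‖⁻¹ with hk
  have hki : Integrable k :=
    (integrable_indicator_iff Metric.isOpen_ball.measurableSet).2
      ((integrableOn_ball_inv_norm R).const_mul D)
  have hk0 : ∀ z, 0 ≤ k z := fun z => indicator_nonneg (fun z _ => by positivity) z
  have hle : ∀ t z, ‖dbar φ z / (z - c t)‖ ≤ k (z - c t) := by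
    intro t z
    by_cases hz : z ∈ tsupport φ
    · have hmem : z - c t ∈ Metric.ball (0 : ℂ) R := by
        rw [mem_ball_zero_iff]
        have := norm_sub_le z (c t)
        have h1 := hM z hz
        have h2 := hM' (c t) ⟨t, rfl⟩
        linarith
      rw [hk, indicator_of_mem hmem, norm_div, div_eq_mul_inv]
      gcongr
      exact hD z
    · rw [dbar_eq_zero hz, zero_div, norm_zero]
      exact hk0 _
  have hmeas : Measurable (Function.uncurry fun (t : ℝ) (z : ℂ) =>
      c' t * (dbar φ z / (z - c t))) := by
    have h1 := h.continuous_deriv.measurable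
    have h2 := h.continuous.measurable
    have h3 := (continuous_dbar hφ).measurable
    simp only [Function.uncurry_def]
    fun_prop
  have hint : ∀ t, Integrable fun z => dbar φ z / (z - c t) := fun t =>
    (hki.comp_sub_right (c t)).mono'
      ((continuous_dbar hφ).measurable.div (measurable_id.sub_const _)).aestronglyMeasurable
      (Eventually.of_forall (hle t))
  rw [integrable_prod_iff hmeas.aestronglyMeasurable]
  refine ⟨Eventually.of_forall fun t => (hint t).const_mul (c' t), ?_⟩
  have : IsFiniteMeasure (volume.restrict (uIoc 0 T)) := by
    rw [uIoc_of_le h.pos.le]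
    infer_instance
  refine Integrable.of_bound (C := N * ∫ z, k z)
    hmeas.norm.stronglyMeasurable.integral_prod_right'.aestronglyMeasurable ?_
  refine (ae_restrict_mem measurableSet_uIoc).mono fun t ht => ?_
  rw [uIoc_of_le h.pos.le] at ht
  have hnonneg : 0 ≤ ∫ z, ‖dbar φ z / (z - c t)‖ := integral_nonneg fun _ => norm_nonneg _
  simp only [Function.uncurry_apply_pair, norm_mul, integral_const_mul, norm_norm]
  rw [Real.norm_of_nonneg hnonneg]
  have hN' := hN t (Ioc_subset_Icc_self ht)
  refine mul_le_mul hN' ?_ hnonneg ((norm_nonneg _).trans hN')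
  rw [← integral_sub_right_eq_self k (c t)]
  exact integral_mono (hint t).norm (hki.comp_sub_right (c t)) (hle t)

/-- Green's formula for a regular simple loop, in terms of winding numbers. -/
theorem integral_eq_integral_dbar_mul_loopWinding (h : IsRegularSimpleLoop c c' T) {φ : ℂ → ℂ}
    (hφ : ContDiff ℝ 1 φ) (hs : HasCompactSupport φ) :
    Integrable (fun z => dbar φ z * loopWinding c c' T z) ∧
    ∫ t in (0 : ℝ)..T, φ (c t) * c' t = I * ∫ z, dbar φ z * loopWinding c c' T z := by
  have hker := h.integrable_kernel hφ hs
  have hpi := two_pi_I_ne_zero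
  have hinner : ∀ z, ∫ t in (0 : ℝ)..T, c' t * (dbar φ z / (z - c t)) =
      -(2 * Real.pi * I) * (dbar φ z * loopWinding c c' T z) := by
    intro z
    have e1 : -(2 * Real.pi * I) * (dbar φ z * loopWinding c c' T z) =
        -dbar φ z * ∫ t in (0 : ℝ)..T, c' t / (c t - z) := by
      rw [loopWinding, mul_left_comm, neg_mul, mul_inv_cancel_left₀ hpi]
      ring
    rw [e1, ← intervalIntegral.integral_const_mul]
    refine intervalIntegral.integral_congr fun t _ => ?_
    rw [← neg_sub (c t) z, div_neg]
    ring
  constructor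
  · have h1 := hker.integral_prod_right.const_mul (-(2 * Real.pi * I : ℂ)⁻¹)
    refine h1.congr (Eventually.of_forall fun z => ?_)
    have h2 := hinner z
    rw [intervalIntegral.integral_of_le h.pos.le, ← uIoc_of_le h.pos.le] at h2
    simp only [Function.uncurry_apply_pair]
    rw [h2, neg_mul, neg_mul, mul_neg, neg_neg, inv_mul_cancel_left₀ hpi]
  · have hCP : ∀ t, φ (c t) * c' t = -(2 * Real.pi : ℂ)⁻¹ * ∫ z, c' t * (dbar φ z / (z - c t)) := by
      intro t
      have h1 := integral_dbar_div hφ hs (c t)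
      rw [← integral_sub_right_eq_self _ (c t)] at h1
      simp only [add_sub_cancel] at h1
      have h2 : (2 * Real.pi : ℂ) ≠ 0 := by simp [Real.pi_ne_zero]
      rw [integral_const_mul, h1]
      field_simp
    simp_rw [hCP]
    rw [intervalIntegral.integral_const_mul, intervalIntegral_integral_swap hker]
    simp_rw [hinner]
    rw [integral_const_mul]
    have h2 : (Real.pi : ℂ) ≠ 0 := by simp [Real.pi_ne_zero]
    field_simp

end IsRegularSimpleLoop

theorem exists_contDiff_hasCompactSupport_eventuallyEq {E F : Type*} [NormedAddCommGroup E]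
    [NormedSpace ℝ E] [FiniteDimensional ℝ E] [NormedAddCommGroup F] [NormedSpace ℝ F]
    {K U : Set E} {f : E → F} (hK : IsCompact K) (hU : IsOpen U) (hKU : K ⊆ U)
    (hf : ContDiffOn ℝ 1 f U) :
    ∃ g : E → F, ContDiff ℝ 1 g ∧ HasCompactSupport g ∧ ∀ z ∈ K, g =ᶠ[𝓝 z] f := by
  obtain ⟨L, hL, hKL, hLU⟩ := exists_compact_between hK hU hKU
  obtain ⟨χ, h1, h0, -⟩ := exists_contMDiffMap_one_nhds_of_subset_interior (n := 1)
    (modelWithCornersSelf ℝ E) hK.isClosed hKL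
  have hχ : ContDiff ℝ 1 χ := χ.contMDiff.contDiff
  have hsub : tsupport χ ⊆ L := closure_minimal (fun z hz => by
    by_contra hnot
    exact hz (h0 z hnot)) hL.isClosed
  have hsub' : tsupport (fun z => χ z • f z) ⊆ tsupport χ := tsupport_smul_subset_left χ f
  refine ⟨fun z => χ z • f z, ?_, hL.of_isClosed_subset (isClosed_tsupport _) (hsub'.trans hsub),
    fun z hz => ?_⟩
  · refine contDiff_iff_contDiffAt.2 fun z => ?_
    by_cases hz : z ∈ U
    · exact hχ.contDiffAt.smul (hf.contDiffAt (hU.mem_nhds hz))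
    · have hz' : z ∉ tsupport (fun z => χ z • f z) := fun h => hz (hLU (hsub (hsub' h)))
      exact contDiffAt_const.congr_of_eventuallyEq (notMem_tsupport_iff_eventuallyEq.1 hz')
  · filter_upwards [h1.filter_mono (nhds_le_nhdsSet hz)] with w hw
    rw [hw, one_smul]

theorem exists_isRegularSimpleLoop {V : ℂ → ℂ} {U : Set ℂ} (hU : IsOpen U)
    (hV : ContDiffOn ℝ 1 V U) {c : ℝ → ℂ} (hc : ∀ t, HasDerivAt c (V (c t)) t)
    (hcU : ∀ t, c t ∈ U) {T : ℝ} (hT : 0 < T) (hper : Function.Periodic c T)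
    (hne : ∃ t₁ t₂, c t₁ ≠ c t₂) :
    ∃ T₀, IsRegularSimpleLoop c (fun t => V (c t)) T₀ := by
  have hcc : Continuous c := continuous_iff_continuousAt.2 fun t => (hc t).continuousAt
  have hK : IsCompact (range c) := hper.compact_of_continuous hT.ne' hcc
  obtain ⟨g, hg, hgs, hgV⟩ := exists_contDiff_hasCompactSupport_eventuallyEq hK hU
    (range_subset_iff.2 hcU) hV
  have hgc : ∀ t, g (c t) = V (c t) := fun t => (hgV _ ⟨t, rfl⟩).eq_of_nhds
  obtain ⟨κ, hκ⟩ := hg.lipschitzWith_of_hasCompactSupport hgs one_ne_zero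
  have huniq : ∀ c₁ c₂ : ℝ → ℂ, (∀ t, HasDerivAt c₁ (g (c₁ t)) t) →
      (∀ t, HasDerivAt c₂ (g (c₂ t)) t) → ∀ t, c₁ t = c₂ t → c₁ = c₂ := fun c₁ c₂ h₁ h₂ t h =>
    ODE_solution_unique_univ (v := fun _ => g) (s := fun _ => univ) (fun _ => hκ.lipschitzOnWith)
      (fun t => ⟨h₁ t, mem_univ _⟩) (fun t => ⟨h₂ t, mem_univ _⟩) h
  have hcg : ∀ t, HasDerivAt c (g (c t)) t := fun t => (hgc t).symm ▸ hc t
  obtain ⟨t₁, t₂, hne⟩ := hne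
  have hV0 : ∀ t, V (c t) ≠ 0 := by
    intro t h0
    have hconst : c = fun _ => c t := huniq _ _ hcg (fun s => by
      rw [hgc, h0]
      exact hasDerivAt_const s _) t rfl
    exact hne (by rw [hconst])
  have hshift : ∀ a b, c a = c b → Function.Periodic c (b - a) := by
    intro a b hab
    refine fun t => congrFun (huniq (fun t => c (t + (b - a))) c (fun s => ?_) hcg a ?_) t
    · exact (hcg (s + (b - a))).comp_add_const s (b - a)
    · simp [hab]
  let G : AddSubgroup ℝ :=
    { carrier := {s | Function.Periodic c s}
      zero_mem' := fun t => by simp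
      add_mem' := fun h₁ h₂ => h₁.add_period h₂
      neg_mem' := fun h => h.neg }
  obtain hd | ⟨T₀, hT₀⟩ := AddSubgroup.dense_or_cyclic G
  · have hconst : c = fun _ => c 0 := hcc.ext_on hd continuous_const fun s hs => by
      simpa using (show Function.Periodic c s from hs) 0
    exact absurd (by rw [hconst]) hne
  · have hmem : ∀ s, Function.Periodic c s ↔ ∃ n : ℤ, n • T₀ = s := fun s => by
      rw [← AddSubgroup.mem_closure_singleton, ← hT₀]
      rfl
    have hT₀0 : T₀ ≠ 0 := by
      rintro rfl
      obtain ⟨n, hn⟩ := (hmem T).1 hper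
      simp at hn
      exact hT.ne hn
    have hper₀ : Function.Periodic c T₀ := (hmem T₀).2 ⟨1, one_smul _ _⟩
    refine ⟨|T₀|, abs_pos.2 hT₀0, hc, hV.continuousOn.comp_continuous hcc hcU, hV0, ?_, ?_⟩
    · rcases abs_choice T₀ with h | h <;> rw [h]
      exacts [hper₀, hper₀.neg]
    · intro a b hab
      obtain ⟨n, hn⟩ := (hmem _).1 (hshift a b hab)
      rw [zsmul_eq_mul] at hn
      rcases abs_choice T₀ with h | h <;> rw [h]
      · exact ⟨n, by linarith⟩
      · exact ⟨-n, by push_cast; linarith⟩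

namespace IsRegularSimpleLoop

variable {c c' : ℝ → ℂ} {T : ℝ}

theorem volume_range (h : IsRegularSimpleLoop c c' T) : volume (range c) = 0 := by
  have himg : range c = (fun z : ℂ => c z.re) '' univ := by
    rw [image_univ]
    exact (re_surjective.range_comp c).symm
  rw [himg]
  refine addHaar_image_eq_zero_of_det_fderivWithin_eq_zero volume
    (f' := fun z => reCLM.smulRight (c' z.re)) (fun z _ => ?_) (fun z _ => ?_)
  · exact ((h.hasDerivAt z.re).hasFDerivAt.comp z reCLM.hasFDerivAt).hasFDerivWithinAt.congr_fderiv
      (by ext; simp)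
  · rw [ContinuousLinearMap.det, LinearMap.det_eq_zero_iff_ker_ne_bot]
    exact fun hbot => I_ne_zero ((Submodule.eq_bot_iff _).1 hbot I (by simp))

theorem loopWinding_eq_zero_of_notMem (h : IsRegularSimpleLoop c c' T) {U : Set ℂ}
    (hU : IsOpen U) [SimplyConnectedSpace U] (hcU : ∀ t, c t ∈ U) {z : ℂ} (hz : z ∉ U) :
    loopWinding c c' T z = 0 := by
  have := hU.locallyPathConnectedSpace
  have hne : c 0 - z ≠ 0 := fun h0 => hz (sub_eq_zero.1 h0 ▸ hcU 0)
  obtain ⟨F, ⟨-, hF⟩, -⟩ := Complex.isCoveringMapOn_exp.existsUnique_continuousMap_lifts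
    (⟨fun w : U => (w : ℂ) - z, by fun_prop⟩ : C(U, ℂ)) (a₀ := ⟨c 0, hcU 0⟩)
    (e₀ := log (c 0 - z)) (exp_log hne) (fun w h0 => hz (sub_eq_zero.1 h0 ▸ w.2))
  refine h.loopWinding_eq_zero_of_log (L := fun t => F ⟨c t, hcU t⟩) ?_ ?_ fun t => ?_
  · have := h.continuous
    fun_prop
  · have hT : c T = c 0 := by simpa using h.periodic 0
    simp only [hT]
  · exact congrFun hF ⟨c t, hcU t⟩


/-- A vector field with positive divergence on a simply connected domain admits no regular simple
loop as an orbit. -/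
theorem false_of_divergence_pos {V : ℂ → ℂ} {U : Set ℂ} (hU : IsOpen U) [SimplyConnectedSpace U]
    (hV : ContDiffOn ℝ 1 V U) (hdiv : ∀ z ∈ U, 0 < (fderiv ℝ V z 1).re + (fderiv ℝ V z I).im)
    (h : IsRegularSimpleLoop c (fun t => V (c t)) T) (hcU : ∀ t, c t ∈ U) : False := by
  set W := loopWinding c (fun t => V (c t)) T with hW
  obtain ⟨σ, hσ, hWσ, z₀, hz₀, hWz₀⟩ := h.exists_sign
  have hσ2 : σ * σ = 1 := by rcases hσ with rfl | rfl <;> norm_num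
  have hσ0 : σ ≠ 0 := fun h0 => by simp [h0] at hσ2
  have hopen : IsOpen (range c)ᶜ := h.isCompact_range.isClosed.isOpen_compl
  have hWc : ContinuousOn W (range c)ᶜ := fun z hz =>
    (h.continuousAt_loopWinding hz).continuousWithinAt
  have hO₀ : IsOpen ((range c)ᶜ ∩ W ⁻¹' {(σ : ℂ)}ᶜ) :=
    hWc.isOpen_inter_preimage hopen isOpen_compl_singleton
  have hO₁ : IsOpen ((range c)ᶜ ∩ W ⁻¹' {0}ᶜ) :=
    hWc.isOpen_inter_preimage hopen isOpen_compl_singleton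
  set K : Set ℂ := ((range c)ᶜ ∩ W ⁻¹' {(σ : ℂ)}ᶜ)ᶜ
  have hmemK : ∀ z, W z ≠ 0 → z ∈ K := fun z hz ⟨hz₁, hz₂⟩ =>
    (hWσ z hz₁).elim hz hz₂
  have hKr : ∀ z ∈ K, z ∉ range c → W z = σ := fun z hz hzr => by
    by_contra hne
    exact hz ⟨hzr, hne⟩
  have hK : IsCompact K := by
    obtain ⟨R, hR⟩ := h.exists_loopWinding_eq_zero
    refine Metric.isCompact_of_isClosed_isBounded hO₀.isClosed_compl
      ((Metric.isBounded_closedBall (x := (0 : ℂ)) (r := R)).subset fun z hz => ?_)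
    rw [mem_closedBall_zero_iff]
    by_contra! hlt
    obtain ⟨h1, h2⟩ := hR z hlt
    have h3 := hKr z hz h1
    rw [hW, h2] at h3
    exact hσ0 (by exact_mod_cast h3.symm)
  have hKU : K ⊆ U := fun z hz => by
    by_contra hzU
    have h1 : z ∉ range c := by
      rintro ⟨t, rfl⟩
      exact hzU (hcU t)
    have h3 := hKr z hz h1
    rw [hW, h.loopWinding_eq_zero_of_notMem hU hcU hzU] at h3
    exact hσ0 (by exact_mod_cast h3.symm)
  have hf : ContDiffOn ℝ 1 (fun z => -I * conjCLE (V z)) U :=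
    contDiffOn_const.mul (conjCLE.contDiff.comp_contDiffOn hV)
  obtain ⟨g, hg, hgs, hgf⟩ := exists_contDiff_hasCompactSupport_eventuallyEq hK hU hKU hf
  have hre : ∀ z ∈ K, 0 < (I * dbar g z).re := by
    intro z hz
    have hVz : HasFDerivAt V (fderiv ℝ V z) z :=
      ((hV.contDiffAt (hU.mem_nhds (hKU hz))).differentiableAt one_ne_zero).hasFDerivAt
    have hd : HasFDerivAt (fun z => -I * conjCLE (V z))
        (-I • (conjCLE : ℂ →L[ℝ] ℂ).comp (fderiv ℝ V z)) z :=
      ((conjCLE : ℂ →L[ℝ] ℂ).hasFDerivAt.comp z hVz).const_mul (-I)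
    have := hdiv z (hKU hz)
    rw [dbar, (hgf z hz).fderiv_eq, hd.fderiv]
    simp
    linarith
  obtain ⟨hint, hgreen⟩ := h.integral_eq_integral_dbar_mul_loopWinding hg hgs
  have hcK : ∀ t, c t ∈ K := fun t ht => ht.1 ⟨t, rfl⟩
  have hline : (∫ t in (0 : ℝ)..T, g (c t) * V (c t)).re = 0 := by
    have h1 : ∀ t, g (c t) * V (c t) = -I * (normSq (V (c t)) : ℂ) := fun t => by
      rw [(hgf _ (hcK t)).eq_of_nhds, normSq_eq_conj_mul_self, mul_assoc]
      rfl
    simp_rw [h1]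
    rw [intervalIntegral.integral_const_mul, intervalIntegral.integral_ofReal]
    simp
  set w : ℂ → ℝ := fun z => σ * (I * (dbar g z * W z)).re with hw
  have hwint : Integrable w := (hint.const_mul I).re.const_mul σ
  have hw0 : ∫ z, w z = 0 := by
    have h1 : ∫ z, (I * (dbar g z * W z)).re = (∫ z, I * (dbar g z * W z)).re :=
      integral_re (hint.const_mul I)
    rw [hw, integral_const_mul, h1, integral_const_mul, ← hgreen, hline, mul_zero]
  have hwK : ∀ z ∉ range c, W z = σ → 0 < w z := fun z hz hzσ => by
    have h1 := hre z (hmemK z (by rw [hzσ]; exact_mod_cast hσ0))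
    have h2 : w z = (σ * σ) * (I * dbar g z).re := by
      simp only [hw, hzσ, ← mul_assoc, re_mul_ofReal]
      ring
    rw [h2, hσ2, one_mul]
    exact h1
  have hpos : 0 ≤ᵐ[volume] w := by
    filter_upwards [measure_eq_zero_iff_ae_notMem.1 h.volume_range] with z hz
    rcases hWσ z hz with h0 | h1
    · simp only [hw, hW, h0]
      simp
    · exact (hwK z hz h1).le
  have hae := (integral_eq_zero_iff_of_nonneg_ae hpos hwint).1 hw0
  have hnull : volume ((range c)ᶜ ∩ W ⁻¹' {0}ᶜ) = 0 := by
    refine measure_mono_null (fun z hz => ?_) hae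
    exact (hwK z hz.1 ((hWσ z hz.1).resolve_left hz.2)).ne'
  refine (hO₁.measure_pos volume ⟨z₀, hz₀, ?_⟩).ne' hnull
  change W z₀ ≠ 0
  rw [hW, hWz₀]
  exact_mod_cast hσ0

end IsRegularSimpleLoop

end

/-- **Bendixson criterion.** Let `Ω ⊆ ℝ²` be an open, simply connected region
and `X = (P, Q)` a `C¹` vector field on `Ω` with `div X > 0` everywhere on `Ω`.
Then the planar ODE `x' = P, y' = Q` has no periodic orbit entirely
contained in `Ω`. -/
theorem bendixson_criterion
    (Ω : Set (ℝ × ℝ)) (hΩopen : IsOpen Ω) (hΩsc : SimplyConnectedSpace Ω)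
    (P Q : ℝ × ℝ → ℝ)
    (hP : ContDiffOn ℝ 1 P Ω) (hQ : ContDiffOn ℝ 1 Q Ω)
    (hdiv : ∀ z ∈ Ω, 0 < fderiv ℝ P z (1, 0) + fderiv ℝ Q z (0, 1)) :
    ¬ ∃ (γ : ℝ → ℝ × ℝ) (T : ℝ), 0 < T ∧
        (∀ t, HasDerivAt γ (P (γ t), Q (γ t)) t) ∧
        (∀ t, γ (t + T) = γ t) ∧
        (∃ t₁ t₂, γ t₁ ≠ γ t₂) ∧
        (∀ t, γ t ∈ Ω) := by
  rintro ⟨γ, T, hT, hγ, hper, ⟨t₁, t₂, hne⟩, hγΩ⟩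
  set e : ℂ ≃L[ℝ] ℝ × ℝ := Complex.equivRealProdCLM
  set U : Set ℂ := e ⁻¹' Ω
  set V : ℂ → ℂ := fun z => e.symm (P (e z), Q (e z))
  set c : ℝ → ℂ := fun t => e.symm (γ t) with hcdef
  have hec : ∀ t, e (c t) = γ t := fun t => e.apply_symm_apply _
  have hU : IsOpen U := hΩopen.preimage e.continuous
  have hUsc : SimplyConnectedSpace U :=
    ((e.toHomeomorph.isSimplyConnected_preimage (s := Ω)).2 hΩsc).simplyConnectedSpace
  have hV : ContDiffOn ℝ 1 V U := e.symm.contDiff.comp_contDiffOn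
    ((hP.prodMk hQ).comp e.contDiff.contDiffOn (Set.mapsTo_preimage _ _))
  have hcU : ∀ t, c t ∈ U := fun t => by
    change e (c t) ∈ Ω
    rw [hec]
    exact hγΩ t
  have hc : ∀ t, HasDerivAt c (V (c t)) t := fun t => by
    have h1 := (e.symm : ℝ × ℝ →L[ℝ] ℂ).hasFDerivAt.comp_hasDerivAt t (hγ t)
    rw [← hec] at h1
    exact h1
  have hdivV : ∀ z ∈ U, 0 < (fderiv ℝ V z 1).re + (fderiv ℝ V z Complex.I).im := fun z hz => by
    have hPz := ((hP.contDiffAt (hΩopen.mem_nhds hz)).differentiableAt one_ne_zero).hasFDerivAt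
    have hQz := ((hQ.contDiffAt (hΩopen.mem_nhds hz)).differentiableAt one_ne_zero).hasFDerivAt
    have hVz : HasFDerivAt V ((e.symm : ℝ × ℝ →L[ℝ] ℂ).comp
        (((fderiv ℝ P (e z)).prod (fderiv ℝ Q (e z))).comp (e : ℂ →L[ℝ] ℝ × ℝ))) z :=
      (e.symm : ℝ × ℝ →L[ℝ] ℂ).hasFDerivAt.comp z
        ((hPz.prodMk hQz).comp z (e : ℂ →L[ℝ] ℝ × ℝ).hasFDerivAt)
    rw [hVz.fderiv]
    exact hdiv (e z) hz
  obtain ⟨T₀, hloop⟩ := exists_isRegularSimpleLoop hU hV hc hcU hT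
    (fun t => by simp only [hcdef, hper]) ⟨t₁, t₂, e.symm.injective.ne hne⟩
  exact hloop.false_of_divergence_pos hU hV hdivV hcU
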